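/- arXiv:2603.18939 — 2 statements merged into one kernel-verified Lean document; each statement's English description precedes it below -/
import Mathlib

section
/- The first-order DOM AND gadget is first-order probing secure in the static (stable) model: for each intermediate wire function w among a0 = a XOR a1, p1 = a0 && b0, p2 = a0 && b1, p3 = a1 && b0, p4 = a1 && b1, i1 = p2 XOR z, i2 = p3 XOR z, y0 = i1 XOR p1, y1 = i2 XOR p4 (with b0 = b XOR b1), and for all pairs of secrets (a, b) and (a', b'), the pushforward of the uniform distribution on (a1, b1, z) ∈ Bool × Bool × Bool under w computed with secrets (a, b) equals the pushforward under w computed with secrets (a', b'); i.e., every single intermediate wire has a distribution independent of the secrets. -/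
/-- Two functions on a finite type push the uniform distribution forward to the same distribution
as soon as their fibers have the same cardinalities. -/
theorem PMF.map_uniformOfFintype_eq_of_card_fiber_eq {α β : Type*} [Fintype α] [Nonempty α]
    [DecidableEq β] {f g : α → β}
    (h : ∀ y, (Finset.univ.filter fun x => y = f x).card =
      (Finset.univ.filter fun x => y = g x).card) :
    PMF.map f (PMF.uniformOfFintype α) = PMF.map g (PMF.uniformOfFintype α) := by
  ext y
  simp only [PMF.map_apply, PMF.uniformOfFintype_apply, tsum_fintype]
  convert_to (∑ x, if y = f x then (Fintype.card α : ENNReal)⁻¹ else 0) =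
    ∑ x, if y = g x then (Fintype.card α : ENNReal)⁻¹ else 0
  rw [← Finset.sum_filter, ← Finset.sum_filter, Finset.sum_const, Finset.sum_const, h y]

/-- First-order probing security of the DOM AND gadget in the static model:
every single intermediate wire has a distribution independent of the secrets. -/
theorem dom_and_first_order_probing_secure :
    ∀ w ∈ ([
        fun (a _b : Bool) (t : Bool × Bool × Bool) => xor a t.1,                -- a0
        fun (a b : Bool) (t : Bool × Bool × Bool) =>
          (xor a t.1) && (xor b t.2.1),                                          -- p1
        fun (a _b : Bool) (t : Bool × Bool × Bool) => (xor a t.1) && t.2.1,      -- p2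
        fun (_a b : Bool) (t : Bool × Bool × Bool) => t.1 && (xor b t.2.1),      -- p3
        fun (_a _b : Bool) (t : Bool × Bool × Bool) => t.1 && t.2.1,             -- p4
        fun (a _b : Bool) (t : Bool × Bool × Bool) =>
          xor ((xor a t.1) && t.2.1) t.2.2,                                      -- i1
        fun (_a b : Bool) (t : Bool × Bool × Bool) =>
          xor (t.1 && (xor b t.2.1)) t.2.2,                                      -- i2
        fun (a b : Bool) (t : Bool × Bool × Bool) =>
          xor (xor ((xor a t.1) && t.2.1) t.2.2) ((xor a t.1) && (xor b t.2.1)), -- y0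
        fun (_a b : Bool) (t : Bool × Bool × Bool) =>
          xor (xor (t.1 && (xor b t.2.1)) t.2.2) (t.1 && t.2.1)                  -- y1
      ] : List (Bool → Bool → Bool × Bool × Bool → Bool)),
      ∀ a b a' b' : Bool,
        PMF.map (w a b) (PMF.uniformOfFintype (Bool × Bool × Bool)) =
          PMF.map (w a' b') (PMF.uniformOfFintype (Bool × Bool × Bool)) := by
  intro w hw a b a' b'
  apply PMF.map_uniformOfFintype_eq_of_card_fiber_eq
  revert a b a' b'
  revert w
  decide
end

section
/- Soundness of the Fourier-coefficient masking criterion: let n ≥ 1, let f : (Fin n → Bool) → Bool, let i ≠ j be indices (i the secret variable, j a mask variable), and define the Fourier coefficient f̂(S) = (2^n)⁻¹ · Σ_{x : Fin n → Bool} χ(f x) · Π_{k ∈ S} χ(x k) for each finite set S of indices. If f̂(S) = 0 for every S with i ∈ S and j ∉ S, then the number of inputs x with x i = true and f x = true equals the number of inputs x with x i = false and f x = true; equivalently, when all coordinates other than i are uniform and independent, the distribution of f(x) is the same whether the secret coordinate x i is true or false. -/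
open Finset

/-- The ±1 (Fourier) encoding of Booleans: `false ↦ 1`, `true ↦ -1`. -/
def chi : Bool → ℚ
  | false => 1
  | true => -1

/-- The Fourier coefficient of `f : (Fin n → Bool) → Bool` at the set `S`. -/
def fhat {n : ℕ} (f : (Fin n → Bool) → Bool) (S : Finset (Fin n)) : ℚ :=
  ((2 : ℚ) ^ n)⁻¹ * ∑ x : Fin n → Bool, chi (f x) * ∏ k ∈ S, chi (x k)

theorem chi_not (b : Bool) : chi (!b) = -chi b := by
  cases b <;> simp [chi]

theorem chi_mul_chi (a b : Bool) :
    chi a * chi b = chi b + 2 * ((if b = true ∧ a = true then 1 else 0) -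
      (if b = false ∧ a = true then 1 else 0)) := by
  cases a <;> cases b <;> norm_num [chi]

theorem sum_chi_apply {n : ℕ} (i : Fin n) : ∑ x : Fin n → Bool, chi (x i) = 0 := by
  refine Finset.sum_involution (fun x _ => Function.update x i (!x i)) ?_ ?_ ?_ ?_
  · intro x _
    simp [chi_not]
  · intro x _ _ hx
    simpa using congrFun hx i
  · simp
  · simp

/-- Soundness of the Fourier-coefficient masking criterion: if every Fourier
coefficient at a set containing the secret index `i` but not the mask index `j`
vanishes, then the distribution of `f` does not depend on the secret coordinate. -/
theorem fourier_masking_criterion_sound {n : ℕ} (hn : 1 ≤ n)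
    (f : (Fin n → Bool) → Bool) (i j : Fin n) (hij : i ≠ j)
    (h : ∀ S : Finset (Fin n), i ∈ S → j ∉ S → fhat f S = 0) :
    (Finset.univ.filter fun x : Fin n → Bool => x i = true ∧ f x = true).card =
      (Finset.univ.filter fun x : Fin n → Bool => x i = false ∧ f x = true).card := by
  have hS : fhat f {i} = 0 := h {i} (by simp) (by simpa using hij.symm)
  have h2 : ((2 : ℚ) ^ n)⁻¹ ≠ 0 := by positivity
  simp only [fhat, mul_eq_zero, h2, false_or, Finset.prod_singleton, chi_mul_chi,
    Finset.sum_add_distrib, sum_chi_apply, ← Finset.mul_sum, Finset.sum_sub_distrib,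
    Finset.sum_boole] at hS
  rw [zero_add, mul_eq_zero, or_iff_right two_ne_zero, sub_eq_zero] at hS
  exact_mod_cast hS
end
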